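/- arXiv:2403.14761 — 2 statements merged into one kernel-verified Lean document; each statement's English description precedes it below -/
import Mathlib

section
/- Let P ⊂ ℝ^d be a convex polytope containing the origin in its interior, and let V be the (finite) set of extreme points of the polar polytope P°. For any choice of positive weights β_v > 0 for v ∈ V, there exists a point c in the interior of P such that Σ_{v ∈ V} β_v · v/(1 − ⟨c, v⟩) = 0; moreover, for each v ∈ V the point v/(1 − ⟨c, v⟩) is an extreme point of (P − c)°. -/
open scoped RealInnerProductSpace

/-- The polar of a set `S ⊆ ℝ^d`: all `x` with `⟪x, s⟫ ≤ 1` for every `s ∈ S`. -/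
def polarSet {d : ℕ} (S : Set (EuclideanSpace ℝ (Fin d))) : Set (EuclideanSpace ℝ (Fin d)) :=
  {x | ∀ s ∈ S, ⟪x, s⟫ ≤ 1}

section Polar

variable {d : ℕ}

theorem pos_of_forall_inner_le {P : Set (EuclideanSpace ℝ (Fin d))}
    (h0 : (0 : EuclideanSpace ℝ (Fin d)) ∈ interior P) {z : EuclideanSpace ℝ (Fin d)} {t : ℝ}
    (hz : ∀ p ∈ P, ⟪z, p⟫ ≤ t) (hne : t = 0 → z ≠ 0) : 0 < t := by
  have h : 0 ≤ t := by simpa using hz 0 (interior_subset h0)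
  refine h.lt_of_ne fun ht => ?_
  obtain ⟨r, hr, hball⟩ := Metric.mem_nhds_iff.1 (mem_interior_iff_mem_nhds.1 h0)
  have hz0 : 0 < ‖z‖ := norm_pos_iff.2 (hne ht.symm)
  have hmem : (r / 2 / ‖z‖) • z ∈ P := by
    apply hball
    rw [mem_ball_zero_iff, norm_smul, Real.norm_of_nonneg (by positivity),
      div_mul_cancel₀ _ hz0.ne']
    linarith
  have h1 := hz _ hmem
  rw [inner_smul_right, real_inner_self_eq_norm_sq, ← ht] at h1
  have : 0 < r / 2 / ‖z‖ * ‖z‖ ^ 2 := by positivity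
  linarith

theorem convex_polarSet (P : Set (EuclideanSpace ℝ (Fin d))) : Convex ℝ (polarSet P) := by
  intro x hx y hy a b ha hb hab s hs
  rw [inner_add_left, inner_smul_left, inner_smul_left]
  have h1 := mul_le_mul_of_nonneg_left (hx s hs) ha
  have h2 := mul_le_mul_of_nonneg_left (hy s hs) hb
  simp only [conj_trivial]
  linarith

theorem isClosed_polarSet (P : Set (EuclideanSpace ℝ (Fin d))) : IsClosed (polarSet P) := by
  have : polarSet P = ⋂ s ∈ P, {x | ⟪x, s⟫ ≤ 1} := by
    ext x
    simp [polarSet]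
  rw [this]
  exact isClosed_biInter fun s _ => isClosed_le (by fun_prop) continuous_const

theorem isCompact_polarSet {P : Set (EuclideanSpace ℝ (Fin d))}
    (h0 : (0 : EuclideanSpace ℝ (Fin d)) ∈ interior P) : IsCompact (polarSet P) := by
  obtain ⟨r, hr, hball⟩ := Metric.mem_nhds_iff.1 (mem_interior_iff_mem_nhds.1 h0)
  refine Metric.isCompact_of_isClosed_isBounded (isClosed_polarSet P)
    ((Metric.isBounded_closedBall (x := 0) (r := 2 / r)).subset fun x hx => ?_)
  rw [mem_closedBall_zero_iff, le_div_iff₀ hr]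
  rcases eq_or_ne x 0 with rfl | hx0
  · simp
  have hn : 0 < ‖x‖ := norm_pos_iff.2 hx0
  have hmem : (r / 2 / ‖x‖) • x ∈ P := by
    apply hball
    rw [mem_ball_zero_iff, norm_smul, Real.norm_of_nonneg (by positivity),
      div_mul_cancel₀ _ hn.ne']
    linarith
  have h1 := hx _ hmem
  rw [inner_smul_right, real_inner_self_eq_norm_sq] at h1
  have : r / 2 / ‖x‖ * ‖x‖ ^ 2 = r / 2 * ‖x‖ := by field_simp
  linarith

/-- Bipolar theorem, tested on the extreme points of the polar only. -/
theorem mem_of_forall_extremePoints_polarSet {P : Set (EuclideanSpace ℝ (Fin d))}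
    (hconv : Convex ℝ P) (hclosed : IsClosed P)
    (h0 : (0 : EuclideanSpace ℝ (Fin d)) ∈ interior P) {x : EuclideanSpace ℝ (Fin d)}
    (hx : ∀ v ∈ Set.extremePoints ℝ (polarSet P), ⟪x, v⟫ ≤ 1) : x ∈ P := by
  have hpolar : ∀ y ∈ polarSet P, ⟪x, y⟫ ≤ 1 := by
    rw [← closure_convexHull_extremePoints (isCompact_polarSet h0) (convex_polarSet P)]
    have hhalf : Convex ℝ {y : EuclideanSpace ℝ (Fin d) | ⟪x, y⟫ ≤ 1} :=
      convex_halfSpace_le (innerₗ (EuclideanSpace ℝ (Fin d)) x).isLinear 1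
    have hhalfClosed : IsClosed {y : EuclideanSpace ℝ (Fin d) | ⟪x, y⟫ ≤ 1} :=
      isClosed_le (by fun_prop) continuous_const
    exact fun y hy => closure_minimal (convexHull_min hx hhalf) hhalfClosed hy
  by_contra hxP
  obtain ⟨f, u, hfu, hux⟩ := geometric_hahn_banach_closed_point hconv hclosed hxP
  have hu : 0 < u := by simpa using hfu 0 (interior_subset h0)
  set w := (InnerProductSpace.toDual ℝ (EuclideanSpace ℝ (Fin d))).symm f
  have hw : ∀ y, ⟪w, y⟫ = f y := fun y => InnerProductSpace.toDual_symm_apply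
  have hmem : u⁻¹ • w ∈ polarSet P := by
    intro p hp
    rw [inner_smul_left, hw, conj_trivial, inv_mul_le_iff₀ hu]
    linarith [hfu p hp]
  have h1 := hpolar _ hmem
  rw [inner_smul_right, real_inner_comm, hw, inv_mul_le_iff₀ hu] at h1
  linarith

theorem smul_mem_extremePoints_polarSet_translate {P : Set (EuclideanSpace ℝ (Fin d))}
    (h0 : (0 : EuclideanSpace ℝ (Fin d)) ∈ interior P) {c v : EuclideanSpace ℝ (Fin d)}
    (hv : v ∈ Set.extremePoints ℝ (polarSet P)) (hcv : ⟪c, v⟫ < 1) :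
    (1 - ⟪c, v⟫)⁻¹ • v ∈ Set.extremePoints ℝ (polarSet ((fun x => x - c) '' P)) := by
  have hs : 0 < 1 - ⟪c, v⟫ := sub_pos.2 hcv
  have key : ∀ z ∈ polarSet ((fun x => x - c) '' P),
      0 < 1 + ⟪c, z⟫ ∧ (1 + ⟪c, z⟫)⁻¹ • z ∈ polarSet P := by
    intro z hz
    have hle : ∀ p ∈ P, ⟪z, p⟫ ≤ 1 + ⟪c, z⟫ := fun p hp => by
      have := hz _ ⟨p, hp, rfl⟩
      rw [inner_sub_right, real_inner_comm c z] at this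
      linarith
    have hpos : 0 < 1 + ⟪c, z⟫ := pos_of_forall_inner_le h0 hle fun h hz0 => by
      simp [hz0] at h
    refine ⟨hpos, fun p hp => ?_⟩
    rw [inner_smul_left, conj_trivial, inv_mul_le_iff₀ hpos, mul_one]
    exact hle p hp
  rw [mem_extremePoints_iff_left] at hv ⊢
  constructor
  · rintro _ ⟨p, hp, rfl⟩
    have := hv.1 p hp
    rw [inner_smul_left, conj_trivial, inv_mul_le_iff₀ hs, inner_sub_right, real_inner_comm c v]
    linarith
  · rintro z₁ hz₁ z₂ hz₂ ⟨a, b, ha, hb, hab, heq⟩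
    obtain ⟨ht₁, hy₁⟩ := key z₁ hz₁
    obtain ⟨ht₂, hy₂⟩ := key z₂ hz₂
    have hc := congrArg (fun y => ⟪c, y⟫) heq
    simp only [inner_add_right, inner_smul_right] at hc
    set s := 1 - ⟪c, v⟫ with hs_def
    set t₁ := 1 + ⟪c, z₁⟫ with ht₁_def
    set t₂ := 1 + ⟪c, z₂⟫ with ht₂_def
    have hsum : s * a * t₁ + s * b * t₂ = 1 := by
      have h1 : s * (a * ⟪c, z₁⟫ + b * ⟪c, z₂⟫) = ⟪c, v⟫ := by
        rw [hc]; field_simp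
      rw [ht₁_def, ht₂_def]
      linear_combination h1 + s * hab + hs_def
    have hyv : t₁⁻¹ • z₁ = v := by
      refine hv.2 _ hy₁ _ hy₂ ⟨s * a * t₁, s * b * t₂, by positivity, by positivity, hsum, ?_⟩
      rw [smul_smul, smul_smul, mul_inv_cancel_right₀ ht₁.ne', mul_inv_cancel_right₀ ht₂.ne',
        mul_smul, mul_smul, ← smul_add, heq, smul_inv_smul₀ hs.ne']
    have hz : z₁ = t₁ • v := by rw [← hyv, smul_inv_smul₀ ht₁.ne']
    have hts : t₁ * s = 1 := by
      have : ⟪c, z₁⟫ = t₁ * ⟪c, v⟫ := by rw [hz, inner_smul_right]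
      rw [hs_def]
      linear_combination ht₁_def + this
    rw [hz, eq_inv_of_mul_eq_one_left hts]

theorem sum_smul_eq_zero_of_isLocalMax {V : Finset (EuclideanSpace ℝ (Fin d))}
    {β : EuclideanSpace ℝ (Fin d) → ℝ} {c : EuclideanSpace ℝ (Fin d)}
    (hc : ∀ v ∈ V, ⟪c, v⟫ < 1)
    (hmax : IsLocalMax (fun x => ∑ v ∈ V, β v * Real.log (1 - ⟪x, v⟫)) c) :
    ∑ v ∈ V, (β v / (1 - ⟪c, v⟫)) • v = 0 := by
  set w := ∑ v ∈ V, (β v / (1 - ⟪c, v⟫)) • v with hw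
  have hderiv : HasDerivAt (fun t : ℝ => ∑ v ∈ V, β v * Real.log (1 - ⟪c + t • w, v⟫))
      (∑ v ∈ V, β v * (-⟪w, v⟫ / (1 - ⟪c, v⟫))) 0 := by
    refine HasDerivAt.fun_sum fun v hv => HasDerivAt.const_mul _ ?_
    have h1 : HasDerivAt (fun t : ℝ => 1 - ⟪c + t • w, v⟫) (-⟪w, v⟫) 0 := by
      simp only [inner_add_left, inner_smul_left, conj_trivial]
      simpa using (((hasDerivAt_id (0 : ℝ)).mul_const ⟪w, v⟫).const_add ⟪c, v⟫).const_sub 1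
    simpa using h1.log (by simpa using (sub_pos.2 (hc v hv)).ne')
  have hloc : IsLocalMax (fun t : ℝ => ∑ v ∈ V, β v * Real.log (1 - ⟪c + t • w, v⟫)) 0 := by
    have hcont : Filter.Tendsto (fun t : ℝ => c + t • w) (nhds 0) (nhds c) := by
      have : Continuous fun t : ℝ => c + t • w := by fun_prop
      simpa using this.tendsto 0
    simpa [IsLocalMax, IsMaxFilter] using hcont.eventually hmax
  have hzero := hloc.hasDerivAt_eq_zero hderiv
  have hnorm : ⟪w, w⟫ = -∑ v ∈ V, β v * (-⟪w, v⟫ / (1 - ⟪c, v⟫)) := by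
    nth_rw 2 [hw]
    rw [inner_sum]
    rw [← Finset.sum_neg_distrib]
    refine Finset.sum_congr rfl fun v _ => ?_
    rw [inner_smul_right]
    ring
  rw [hzero, neg_zero] at hnorm
  exact inner_self_eq_zero.1 hnorm

end Polar

/-- **Weighted polarity trick.** Let `P ⊆ ℝ^d` be a convex polytope containing the origin in
its interior and let `V` be the finite set of extreme points of the polar polytope `P°`.
For any positive weights `β v > 0`, `v ∈ V`, there is a point `c` in the interior of `P`
with `∑_{v ∈ V} (β v / (1 - ⟪c, v⟫)) • v = 0`; moreover each `v / (1 - ⟪c, v⟫)` is an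
extreme point of `(P - c)°`. -/
theorem polarity_trick_weighted_sum_of_vertices (d : ℕ) (G : Finset (EuclideanSpace ℝ (Fin d)))
    (P : Set (EuclideanSpace ℝ (Fin d)))
    (hP : P = convexHull ℝ (G : Set (EuclideanSpace ℝ (Fin d))))
    (h0 : (0 : EuclideanSpace ℝ (Fin d)) ∈ interior P)
    (V : Finset (EuclideanSpace ℝ (Fin d)))
    (hV : (V : Set (EuclideanSpace ℝ (Fin d))) = Set.extremePoints ℝ (polarSet P))
    (β : EuclideanSpace ℝ (Fin d) → ℝ) (hβ : ∀ v ∈ V, 0 < β v) :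
    ∃ c ∈ interior P,
      (∑ v ∈ V, (β v / (1 - ⟪c, v⟫)) • v) = 0 ∧
      ∀ v ∈ V, (1 - ⟪c, v⟫)⁻¹ • v ∈
        Set.extremePoints ℝ (polarSet ((fun x => x - c) '' P)) := by
  have hcompact : IsCompact P := hP ▸ G.finite_toSet.isCompact_convexHull ℝ
  have hconv : Convex ℝ P := hP ▸ convex_convexHull ℝ _
  have hVP : ∀ v ∈ V, v ∈ Set.extremePoints ℝ (polarSet P) := fun v hv => by
    rwa [← hV, Finset.mem_coe]
  have hle : ∀ x ∈ P, ∀ v ∈ V, ⟪x, v⟫ ≤ 1 := fun x hx v hv => by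
    rw [real_inner_comm]
    exact (hVP v hv).1 x hx
  have hcont : Continuous fun x : EuclideanSpace ℝ (Fin d) =>
      ∏ v ∈ V, (1 - ⟪x, v⟫) ^ β v :=
    continuous_finsetProd _ fun v hv =>
      Continuous.rpow_const (by fun_prop) fun _ => Or.inr (hβ v hv).le
  obtain ⟨c, hcP, hcmax⟩ :=
    hcompact.exists_isMaxOn ⟨0, interior_subset h0⟩ hcont.continuousOn
  have hprod : 1 ≤ ∏ v ∈ V, (1 - ⟪c, v⟫) ^ β v := by
    simpa using hcmax (interior_subset h0)
  have hc : ∀ v ∈ V, ⟪c, v⟫ < 1 := fun v hv => by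
    refine (hle c hcP v hv).lt_of_ne fun h => ?_
    rw [Finset.prod_eq_zero hv (by rw [h, sub_self, Real.zero_rpow (hβ v hv).ne'])] at hprod
    linarith
  have hopen : IsOpen {x : EuclideanSpace ℝ (Fin d) | ∀ v ∈ V, ⟪x, v⟫ < 1} := by
    simp only [Set.ofPred_forall]
    exact isOpen_biInter_finset fun v _ => isOpen_lt (by fun_prop) continuous_const
  have hsub : {x : EuclideanSpace ℝ (Fin d) | ∀ v ∈ V, ⟪x, v⟫ < 1} ⊆ P := fun x hx =>
    mem_of_forall_extremePoints_polarSet hconv hcompact.isClosed h0 fun v hv =>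
      (hx v (by rwa [← hV, Finset.mem_coe] at hv)).le
  refine ⟨c, interior_maximal hsub hopen hc, sum_smul_eq_zero_of_isLocalMax hc ?_,
    fun v hv => smul_mem_extremePoints_polarSet_translate h0 (hVP v hv) (hc v hv)⟩
  have hlog : ∀ x : EuclideanSpace ℝ (Fin d), (∀ v ∈ V, ⟪x, v⟫ < 1) →
      ∑ v ∈ V, β v * Real.log (1 - ⟪x, v⟫) = Real.log (∏ v ∈ V, (1 - ⟪x, v⟫) ^ β v) :=
    fun x hx => by
      rw [Real.log_prod fun v hv => (Real.rpow_pos_of_pos (sub_pos.2 (hx v hv)) _).ne']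
      exact Finset.sum_congr rfl fun v hv => (Real.log_rpow (sub_pos.2 (hx v hv)) _).symm
  filter_upwards [hopen.mem_nhds hc] with x hx
  rw [hlog x hx, hlog c hc]
  exact Real.log_le_log
    (Finset.prod_pos fun v hv => Real.rpow_pos_of_pos (sub_pos.2 (hx v hv)) _) (hcmax (hsub hx))
end

section
/- Let P ⊂ ℝ^d be a convex polytope containing both the origin and a point c in its interior. Set Q = P° and L = (P − c)°. Then a point v ∈ ℝ^d is an extreme point of Q if and only if v/(1 − ⟨c, v⟩) is an extreme point of L. (Note that ⟨c, v⟩ < 1 for every extreme point v of Q, since c lies in the interior of P.) -/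
open scoped RealInnerProductSpace

/-- A point of the polar pairs to strictly less than `1` with interior points. -/
theorem inner_lt_one_of_mem_polarSet {d : ℕ} {S : Set (EuclideanSpace ℝ (Fin d))}
    {c v : EuclideanSpace ℝ (Fin d)} (hc : c ∈ interior S) (hv : v ∈ polarSet S) :
    ⟪c, v⟫ < 1 := by
  by_cases hv0 : v = 0
  · simp [hv0]
  have hcont : Filter.Tendsto (fun ε : ℝ => c + ε • v) (nhdsWithin 0 (Set.Ioi 0)) (nhds c) := by
    have h : Continuous fun ε : ℝ => c + ε • v := by fun_prop
    simpa using (h.tendsto 0).mono_left nhdsWithin_le_nhds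
  obtain ⟨ε, hεS, hε⟩ :=
    ((hcont.eventually (mem_interior_iff_mem_nhds.1 hc)).and self_mem_nhdsWithin).exists
  have h1 : ⟪v, c + ε • v⟫ ≤ 1 := hv _ hεS
  rw [inner_add_right, real_inner_smul_right, real_inner_comm] at h1
  have h2 : 0 < ⟪v, v⟫ := real_inner_self_pos.2 hv0
  have h3 : 0 < ε * ⟪v, v⟫ := mul_pos hε h2
  linarith

/-- The projective map `v ↦ v / (1 - ⟪c, v⟫)` carries the polar of `S` to that of `S - c`. -/
theorem smul_mem_polarSet_image_sub_iff {d : ℕ} {S : Set (EuclideanSpace ℝ (Fin d))}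
    {c v : EuclideanSpace ℝ (Fin d)} (h : 0 < 1 - ⟪c, v⟫) :
    (1 - ⟪c, v⟫)⁻¹ • v ∈ polarSet ((fun x => x - c) '' S) ↔ v ∈ polarSet S := by
  simp only [polarSet, Set.mem_ofPred_eq, Set.forall_mem_image]
  refine forall₂_congr fun x _ => ?_
  rw [real_inner_smul_left, inv_mul_le_iff₀ h, inner_sub_right, real_inner_comm v c]
  constructor <;> intro <;> linarith

/-- The map `w ↦ w / (1 - ⟪-c, w⟫)` is inverse to `v ↦ v / (1 - ⟪c, v⟫)`. -/
theorem one_sub_inner_neg_smul {d : ℕ} {c v : EuclideanSpace ℝ (Fin d)}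
    (h : 1 - ⟪c, v⟫ ≠ 0) :
    1 - ⟪-c, (1 - ⟪c, v⟫)⁻¹ • v⟫ = (1 - ⟪c, v⟫)⁻¹ := by
  rw [inner_neg_left, real_inner_smul_right]
  field_simp
  ring

theorem image_sub_neg_image_sub {d : ℕ} (S : Set (EuclideanSpace ℝ (Fin d)))
    (c : EuclideanSpace ℝ (Fin d)) :
    (fun x => x - -c) '' ((fun x => x - c) '' S) = S := by
  simp [Set.image_image]

theorem sub_mem_interior_image_sub {d : ℕ} {S : Set (EuclideanSpace ℝ (Fin d))}
    {x : EuclideanSpace ℝ (Fin d)} (c : EuclideanSpace ℝ (Fin d)) (hx : x ∈ interior S) :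
    x - c ∈ interior ((fun y => y - c) '' S) :=
  (Homeomorph.subRight c).image_interior S ▸ Set.mem_image_of_mem _ hx

/-- Extreme points of the polar of `S` are carried to extreme points of the polar of `S - c`. -/
theorem smul_mem_extremePoints_polarSet {d : ℕ} {S : Set (EuclideanSpace ℝ (Fin d))}
    {c v : EuclideanSpace ℝ (Fin d)} (h0 : 0 ∈ interior S) (hc : c ∈ interior S)
    (hv : v ∈ Set.extremePoints ℝ (polarSet S)) :
    (1 - ⟪c, v⟫)⁻¹ • v ∈ Set.extremePoints ℝ (polarSet ((fun x => x - c) '' S)) := by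
  have ht : 0 < 1 - ⟪c, v⟫ := sub_pos.2 (inner_lt_one_of_mem_polarSet hc hv.1)
  have hpos : ∀ x ∈ polarSet ((fun x => x - c) '' S), 0 < 1 - ⟪-c, x⟫ := fun x hx =>
    sub_pos.2 (inner_lt_one_of_mem_polarSet (by simpa using sub_mem_interior_image_sub c h0) hx)
  have hmem : ∀ x ∈ polarSet ((fun x => x - c) '' S), (1 - ⟪-c, x⟫)⁻¹ • x ∈ polarSet S := by
    intro x hx
    have := (smul_mem_polarSet_image_sub_iff (hpos x hx)).2 hx
    rwa [image_sub_neg_image_sub] at this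
  refine ⟨(smul_mem_polarSet_image_sub_iff ht).2 hv.1, ?_⟩
  rintro x hx y hy ⟨a, b, ha, hb, hab, hxy⟩
  have hsx := hpos x hx
  have hsy := hpos y hy
  have hs : a * (1 - ⟪-c, x⟫) + b * (1 - ⟪-c, y⟫) = (1 - ⟪c, v⟫)⁻¹ := by
    rw [← one_sub_inner_neg_smul ht.ne', ← hxy, inner_add_right, real_inner_smul_right,
      real_inner_smul_right]
    linear_combination hab
  have hvx : (1 - ⟪-c, x⟫)⁻¹ • x = v := by
    refine hv.2 (hmem x hx) (hmem y hy) ⟨(1 - ⟪c, v⟫) * (a * (1 - ⟪-c, x⟫)),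
      (1 - ⟪c, v⟫) * (b * (1 - ⟪-c, y⟫)), by positivity, by positivity, ?_, ?_⟩
    · rw [← mul_add, hs, mul_inv_cancel₀ ht.ne']
    · rw [smul_smul, smul_smul, mul_assoc, mul_assoc, mul_assoc, mul_assoc,
        mul_inv_cancel₀ hsx.ne', mul_inv_cancel₀ hsy.ne', mul_one, mul_one, mul_smul, mul_smul,
        ← smul_add, hxy, smul_inv_smul₀ ht.ne']
  have hinv := one_sub_inner_neg_smul hsx.ne'
  rw [neg_neg, hvx] at hinv
  rw [hinv, inv_inv, ← hvx, smul_inv_smul₀ hsx.ne']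

/-- If `0` is an extreme point of the polar of a bounded set, then the space is trivial. -/
theorem eq_zero_of_zero_mem_extremePoints_polarSet {d : ℕ}
    {S : Set (EuclideanSpace ℝ (Fin d))} (hS : Bornology.IsBounded S)
    (h : 0 ∈ Set.extremePoints ℝ (polarSet S)) (v : EuclideanSpace ℝ (Fin d)) : v = 0 := by
  obtain ⟨M, hM, hSM⟩ := hS.exists_pos_norm_le
  have hε : 0 < (M * (‖v‖ + 1))⁻¹ := by positivity
  have key : ∀ u : EuclideanSpace ℝ (Fin d), ‖u‖ = ‖v‖ →
      (M * (‖v‖ + 1))⁻¹ • u ∈ polarSet S := by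
    intro u hu s hs
    rw [real_inner_smul_left, inv_mul_le_iff₀ (by positivity)]
    calc ⟪u, s⟫ ≤ ‖u‖ * ‖s‖ := real_inner_le_norm u s
      _ ≤ ‖v‖ * M := by rw [hu]; gcongr; exact hSM s hs
      _ ≤ M * (‖v‖ + 1) * 1 := by nlinarith
  have h2 := h.2 (key v rfl) (key (-v) (norm_neg v))
    ⟨1 / 2, 1 / 2, by norm_num, by norm_num, by norm_num, by simp⟩
  exact (smul_eq_zero.1 h2).resolve_left hε.ne'

/-- **Vertex correspondence.** Let `P ⊆ ℝ^d` be a convex polytope containing both the origin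
and a point `c` in its interior, and set `Q = P°`, `L = (P - c)°`. Then `v` is an extreme
point of `Q` if and only if `(1 - ⟪c, v⟫)⁻¹ • v` is an extreme point of `L`. -/
theorem polar_vertex_correspondence (d : ℕ) (F : Finset (EuclideanSpace ℝ (Fin d)))
    (P : Set (EuclideanSpace ℝ (Fin d)))
    (hP : P = convexHull ℝ (F : Set (EuclideanSpace ℝ (Fin d))))
    (h0 : (0 : EuclideanSpace ℝ (Fin d)) ∈ interior P)
    (c : EuclideanSpace ℝ (Fin d)) (hc : c ∈ interior P)
    (Q L : Set (EuclideanSpace ℝ (Fin d)))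
    (hQ : Q = polarSet P) (hL : L = polarSet ((fun x => x - c) '' P))
    (v : EuclideanSpace ℝ (Fin d)) :
    v ∈ Set.extremePoints ℝ Q ↔ (1 - ⟪c, v⟫)⁻¹ • v ∈ Set.extremePoints ℝ L := by
  subst hQ hL
  refine ⟨smul_mem_extremePoints_polarSet h0 hc, fun h => ?_⟩
  have h0' : -c ∈ interior ((fun x => x - c) '' P) := by
    simpa using sub_mem_interior_image_sub c h0
  have hc' : 0 ∈ interior ((fun x => x - c) '' P) := by
    simpa using sub_mem_interior_image_sub c hc
  have hbdd : Bornology.IsBounded ((fun x => x - c) '' P) := by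
    have hPc : IsCompact P := hP ▸ F.finite_toSet.isCompact_convexHull ℝ
    exact (hPc.image (by fun_prop)).isBounded
  have ht : 1 - ⟪c, v⟫ ≠ 0 := by
    intro ht
    rw [ht, inv_zero, zero_smul] at h
    simp [eq_zero_of_zero_mem_extremePoints_polarSet hbdd h v] at ht
  have hback := smul_mem_extremePoints_polarSet hc' h0' h
  rwa [image_sub_neg_image_sub, one_sub_inner_neg_smul ht, inv_inv, smul_inv_smul₀ ht] at hback
end
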